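/- The past of a timelike curve equals the past of its endpoint: if c : [0, 1] → M is continuous and future-directed timelike, i.e. c(s) ≪ c(t) whenever 0 ≤ s < t ≤ 1, then ⋃_{t ∈ [0,1)} I⁻(c(t)) = I⁻(c(1)). -/

import Mathlib

open Set

/-- Minkowski space: time coordinate × space. -/
abbrev Mink (n : ℕ) := ℝ × EuclideanSpace ℝ (Fin n)

/-- The chronological relation `p ≪ q` on Minkowski space. -/
def chronRel {n : ℕ} (p q : Mink n) : Prop := ‖q.2 - p.2‖ < q.1 - p.1

/-- The chronological past `I⁻(x)`. -/
def chronPast {n : ℕ} (x : Mink n) : Set (Mink n) := {w | chronRel w x}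

/-- The chronological relation is transitive. -/
theorem chronRel.trans {n : ℕ} {p q r : Mink n} (hpq : chronRel p q) (hqr : chronRel q r) :
    chronRel p r := by
  unfold chronRel at *
  linarith [norm_sub_le_norm_sub_add_norm_sub r.2 q.2 p.2]

/-- The chronological future `I⁺(x)` is open. -/
theorem isOpen_setOf_chronRel {n : ℕ} (x : Mink n) : IsOpen {w | chronRel x w} :=
  isOpen_lt (by fun_prop) (by fun_prop)

/-- The past of a future-directed timelike curve `c : [0,1] → M` equals the
past of its endpoint `c 1`. -/
theorem chronPast_curve_eq_chronPast_endpoint (n : ℕ) (c : ℝ → Mink n)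
    (hcont : ContinuousOn c (Icc (0 : ℝ) 1))
    (htl : ∀ s t : ℝ, 0 ≤ s → s < t → t ≤ 1 → chronRel (c s) (c t)) :
    (⋃ t ∈ Ico (0 : ℝ) 1, chronPast (c t)) = chronPast (c 1) := by
  ext w
  simp only [mem_iUnion, exists_prop]
  refine ⟨fun ⟨t, ht, hw⟩ => chronRel.trans hw (htl t 1 ht.1 ht.2 le_rfl), fun hw => ?_⟩
  have hlim : Filter.Tendsto c (nhdsWithin 1 (Ico 0 1)) (nhds (c 1)) :=
    (hcont 1 (right_mem_Icc.2 zero_le_one)).mono Ico_subset_Icc_self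
  have : (nhdsWithin (1 : ℝ) (Ico 0 1)).NeBot := right_nhdsWithin_Ico_neBot zero_lt_one
  have hev := hlim.eventually ((isOpen_setOf_chronRel w).mem_nhds hw)
  obtain ⟨t, hwt, ht⟩ := (hev.and self_mem_nhdsWithin).exists
  exact ⟨t, ht, hwt⟩
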